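/- arXiv:2508.12222 — 5 statements merged into one kernel-verified Lean document; each statement's English description precedes it below -/
import Mathlib

section
/- Let E be a finite-dimensional real inner product space (e.g., EuclideanSpace ℝ (Fin n)), let π be a probability measure on E × E, and write μ and ν for its first and second marginals. Let f : ℝ → E → E be such that f 0 is measurable, f 1 is the identity map, and for π-almost every pair (x₀, x₁) the function t ↦ f t ((1−t)•x₀ + t•x₁) is constant on [0,1]. Then the pushforward of μ under f 0 equals ν, i.e., Measure.map (f 0) μ = ν. -/
open MeasureTheory

/-- If `π` is a probability measure on `E × E` with marginals `μ` and `ν`,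
`f 0` is measurable, `f 1 = id`, and for `π`-a.e. pair `(x₀, x₁)` the map
`t ↦ f t ((1-t)•x₀ + t•x₁)` is constant on `[0,1]`, then the pushforward of
`μ` under `f 0` equals `ν`. -/
theorem consistency_pushforward_marginal
    {E : Type*} [NormedAddCommGroup E] [InnerProductSpace ℝ E]
    [FiniteDimensional ℝ E] [MeasurableSpace E] [BorelSpace E]
    (π : Measure (E × E)) [IsProbabilityMeasure π]
    (μ ν : Measure E)
    (hμ : μ = Measure.map Prod.fst π) (hν : ν = Measure.map Prod.snd π)
    (f : ℝ → E → E)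
    (hf0 : Measurable (f 0))
    (hf1 : f 1 = id)
    (hconst : ∀ᵐ p ∂π, ∀ s ∈ Set.Icc (0:ℝ) 1, ∀ t ∈ Set.Icc (0:ℝ) 1,
      f s ((1 - s) • p.1 + s • p.2) = f t ((1 - t) • p.1 + t • p.2)) :
    Measure.map (f 0) μ = ν := by
  rw [hμ, hν, Measure.map_map hf0 measurable_fst]
  refine Measure.map_congr ?_
  filter_upwards [hconst] with p hp
  simpa [hf1] using hp 0 (by simp) 1 (by simp)
end

section
/- Let Z be a measurable space with a probability measure ρ₀, let E be a finite-dimensional real inner product space, let ρ₁ be a probability measure on E, let h : Z → E be measurable, and set μ := Measure.map h ρ₀. Let π be a coupling of μ and ρ₁, and let f : ℝ → E → E be such that f 0 is measurable, f 1 is the identity map, and for π-almost every pair (x₀, x₁) the function t ↦ f t ((1−t)•x₀ + t•x₁) is constant on [0,1]. Then the composite map g := (f 0) ∘ h pushes ρ₀ forward to ρ₁, i.e., Measure.map ((f 0) ∘ h) ρ₀ = ρ₁; consequently g solves the distribution matching problem of transporting ρ₀ to ρ₁. -/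
open MeasureTheory

/-- Proposition 1 (measure-theoretic content): if `h : Z → E` is measurable,
`π` is a coupling of `μ := map h ρ₀` and `ρ₁`, `f 0` is measurable, `f 1 = id`,
and for `π`-a.e. `(x₀, x₁)` the map `t ↦ f t ((1-t)•x₀ + t•x₁)` is constant on
`[0,1]`, then `g := f 0 ∘ h` pushes `ρ₀` forward to `ρ₁`. -/
theorem consistency_latent_pushforward
    {Z : Type*} [MeasurableSpace Z] (ρ₀ : Measure Z) [IsProbabilityMeasure ρ₀]
    {E : Type*} [NormedAddCommGroup E] [InnerProductSpace ℝ E]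
    [FiniteDimensional ℝ E] [MeasurableSpace E] [BorelSpace E]
    (ρ₁ : Measure E) [IsProbabilityMeasure ρ₁]
    (h : Z → E) (hh : Measurable h)
    (μ : Measure E) (hμ : μ = Measure.map h ρ₀)
    (π : Measure (E × E)) [IsProbabilityMeasure π]
    (hπ₁ : Measure.map Prod.fst π = μ) (hπ₂ : Measure.map Prod.snd π = ρ₁)
    (f : ℝ → E → E)
    (hf0 : Measurable (f 0))
    (hf1 : f 1 = id)
    (hconst : ∀ᵐ p ∂π, ∀ s ∈ Set.Icc (0:ℝ) 1, ∀ t ∈ Set.Icc (0:ℝ) 1,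
      f s ((1 - s) • p.1 + s • p.2) = f t ((1 - t) • p.1 + t • p.2)) :
    Measure.map ((f 0) ∘ h) ρ₀ = ρ₁ := by
  have hae : f 0 ∘ Prod.fst =ᵐ[π] Prod.snd := by
    filter_upwards [hconst] with p hp
    simpa [hf1] using hp 0 (by simp) 1 (by simp)
  rw [← Measure.map_map hf0 hh, ← hμ, ← hπ₁, Measure.map_map hf0 measurable_fst,
    Measure.map_congr hae, hπ₂]
end

section
/- Let Z be a measurable space with a probability measure ρ₀, let E be a finite-dimensional real inner product space, let ρ₁ be a probability measure on E, let g : Z → E be measurable, and set μ := Measure.map g ρ₀. Let π be a coupling of μ and ρ₁, and let f : ℝ → E → E be such that f 0 is measurable, f 1 is the identity map, for π-almost every pair (x₀, x₁) the function t ↦ f t ((1−t)•x₀ + t•x₁) is constant on [0,1], and additionally f 0 (g z) = g z for ρ₀-almost every z (vanishing generator loss). Then Measure.map g ρ₀ = ρ₁. -/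
open MeasureTheory

/-- Proposition 2 (measure-theoretic content): if `g : Z → E` is measurable,
`π` is a coupling of `μ := map g ρ₀` and `ρ₁`, `f 0` is measurable, `f 1 = id`,
for `π`-a.e. `(x₀, x₁)` the map `t ↦ f t ((1-t)•x₀ + t•x₁)` is constant on
`[0,1]`, and the generator loss vanishes (`f 0 (g z) = g z` for `ρ₀`-a.e. `z`),
then `g` pushes `ρ₀` forward to `ρ₁`. -/
theorem fdm_zero_loss_pushforward
    {Z : Type*} [MeasurableSpace Z] (ρ₀ : Measure Z) [IsProbabilityMeasure ρ₀]
    {E : Type*} [NormedAddCommGroup E] [InnerProductSpace ℝ E]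
    [FiniteDimensional ℝ E] [MeasurableSpace E] [BorelSpace E]
    (ρ₁ : Measure E) [IsProbabilityMeasure ρ₁]
    (g : Z → E) (hg : Measurable g)
    (μ : Measure E) (hμ : μ = Measure.map g ρ₀)
    (π : Measure (E × E)) [IsProbabilityMeasure π]
    (hπ₁ : Measure.map Prod.fst π = μ) (hπ₂ : Measure.map Prod.snd π = ρ₁)
    (f : ℝ → E → E)
    (hf0 : Measurable (f 0))
    (hf1 : f 1 = id)
    (hconst : ∀ᵐ p ∂π, ∀ s ∈ Set.Icc (0:ℝ) 1, ∀ t ∈ Set.Icc (0:ℝ) 1,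
      f s ((1 - s) • p.1 + s • p.2) = f t ((1 - t) • p.1 + t • p.2))
    (hgen : ∀ᵐ z ∂ρ₀, f 0 (g z) = g z) :
    Measure.map g ρ₀ = ρ₁ := by
  have hfix : ∀ᵐ x ∂(Measure.map Prod.fst π), f 0 x = x := by
    rw [hπ₁, hμ]
    exact (ae_map_iff hg.aemeasurable (measurableSet_eq_fun hf0 measurable_id)).2 hgen
  have hdiag : Prod.fst =ᵐ[π] Prod.snd := by
    filter_upwards [hconst, ae_of_ae_map measurable_fst.aemeasurable hfix] with p hp hx
    have h := hp 0 (by simp) 1 (by simp)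
    simp only [sub_zero, one_smul, zero_smul, add_zero, sub_self, zero_add, hf1, id_eq] at h
    exact hx.symm.trans h
  rw [← hμ, ← hπ₁, ← hπ₂]
  exact Measure.map_congr hdiag
end

section
/- Let μ be a probability measure on ℝ and let σ > 0. Define p : ℝ → ℝ by p x = ∫ (Real.sqrt (2 * π * σ^2))⁻¹ * Real.exp (−(x − y)^2 / (2 * σ^2)) dμ(y). Then p x > 0 for every x ∈ ℝ, the function x ↦ Real.log (p x) is differentiable at every x, and deriv (fun x => Real.log (p x)) x = (1 / (σ^2 * p x)) * ∫ (y − x) * (Real.sqrt (2 * π * σ^2))⁻¹ * Real.exp (−(x − y)^2 / (2 * σ^2)) dμ(y). -/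
open MeasureTheory Real

/-- The first moment function `u * exp (-u² / (2σ²))` of the Gaussian kernel is bounded by `σ`. -/
lemma abs_mul_exp_neg_sq_div_le {σ : ℝ} (hσ : 0 < σ) (u : ℝ) :
    |u| * Real.exp (-u ^ 2 / (2 * σ ^ 2)) ≤ σ := by
  have hexp : u ^ 2 / (2 * σ ^ 2) + 1 ≤ Real.exp (u ^ 2 / (2 * σ ^ 2)) := Real.add_one_le_exp _
  have hu : |u| ≤ σ * (u ^ 2 / (2 * σ ^ 2) + 1) := by
    rw [← sq_abs u, show σ * (|u| ^ 2 / (2 * σ ^ 2) + 1) = (|u| ^ 2 + 2 * σ ^ 2) / (2 * σ) by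
      field_simp, le_div_iff₀ (by positivity)]
    nlinarith [sq_nonneg (|u| - σ), sq_nonneg σ]
  rw [neg_div, Real.exp_neg, ← div_eq_mul_inv, div_le_iff₀ (Real.exp_pos _)]
  exact hu.trans (mul_le_mul_of_nonneg_left hexp hσ.le)

lemma hasDerivAt_exp_neg_sub_sq_div {σ : ℝ} (hσ : 0 < σ) (x y : ℝ) :
    HasDerivAt (fun x => Real.exp (-(x - y) ^ 2 / (2 * σ ^ 2)))
      ((σ ^ 2)⁻¹ * ((y - x) * Real.exp (-(x - y) ^ 2 / (2 * σ ^ 2)))) x := by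
  have h := ((((hasDerivAt_id x).sub_const y).pow 2).neg.div_const (2 * σ ^ 2)).exp
  refine h.congr_deriv ?_
  simp
  field_simp
  ring

lemma integrable_exp_neg_sub_sq_div (μ : Measure ℝ) [IsFiniteMeasure μ] (σ x : ℝ) :
    Integrable (fun y => Real.exp (-(x - y) ^ 2 / (2 * σ ^ 2))) μ := by
  refine Integrable.of_bound (C := 1) (by fun_prop) (ae_of_all _ fun y => ?_)
  rw [Real.norm_eq_abs, Real.abs_exp, Real.exp_le_one_iff, neg_div]
  exact neg_nonpos.2 (by positivity)

/-- Differentiation under the integral sign for the Gaussian smoothing of a finite measure. -/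
lemma hasDerivAt_integral_exp_neg_sub_sq_div (μ : Measure ℝ) [IsFiniteMeasure μ] {σ : ℝ}
    (hσ : 0 < σ) (x : ℝ) :
    HasDerivAt (fun x => ∫ y, Real.exp (-(x - y) ^ 2 / (2 * σ ^ 2)) ∂μ)
      ((σ ^ 2)⁻¹ * ∫ y, (y - x) * Real.exp (-(x - y) ^ 2 / (2 * σ ^ 2)) ∂μ) x := by
  rw [← integral_const_mul]
  refine (hasDerivAt_integral_of_dominated_loc_of_deriv_le (s := Set.univ)
    (bound := fun _ => (σ ^ 2)⁻¹ * σ)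
    (F' := fun x y => (σ ^ 2)⁻¹ * ((y - x) * Real.exp (-(x - y) ^ 2 / (2 * σ ^ 2))))
    Filter.univ_mem (Filter.Eventually.of_forall fun x => by fun_prop)
    (integrable_exp_neg_sub_sq_div μ σ x) (by fun_prop) (ae_of_all _ fun y x _ => ?_)
    (integrable_const _) (ae_of_all _ fun y x _ => hasDerivAt_exp_neg_sub_sq_div hσ x y)).2
  rw [norm_mul, norm_mul, Real.norm_of_nonneg (by positivity : 0 ≤ (σ ^ 2)⁻¹),
    Real.norm_eq_abs, Real.norm_eq_abs, Real.abs_exp, abs_sub_comm]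
  exact mul_le_mul_of_nonneg_left (abs_mul_exp_neg_sq_div_le hσ (x - y)) (by positivity)

/-- The Gaussian-smoothed density `p` of a probability measure `μ` on `ℝ` is
everywhere positive, `log ∘ p` is differentiable everywhere, and the score
satisfies `(log p)'(x) = (1/(σ² p x)) ∫ (y-x) (√(2πσ²))⁻¹ exp(-(x-y)²/(2σ²)) dμ(y)`. -/
theorem score_of_gaussian_smoothed_density
    (μ : Measure ℝ) [IsProbabilityMeasure μ] (σ : ℝ) (hσ : 0 < σ)
    (p : ℝ → ℝ)
    (hp : ∀ x, p x =
      ∫ y, (Real.sqrt (2 * Real.pi * σ ^ 2))⁻¹ *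
        Real.exp (-(x - y) ^ 2 / (2 * σ ^ 2)) ∂μ) :
    ∀ x, 0 < p x ∧
      DifferentiableAt ℝ (fun x => Real.log (p x)) x ∧
      deriv (fun x => Real.log (p x)) x =
        (1 / (σ ^ 2 * p x)) *
          ∫ y, (y - x) * (Real.sqrt (2 * Real.pi * σ ^ 2))⁻¹ *
            Real.exp (-(x - y) ^ 2 / (2 * σ ^ 2)) ∂μ := by
  intro x
  have hp_eq : p = fun x => (Real.sqrt (2 * Real.pi * σ ^ 2))⁻¹ *
      ∫ y, Real.exp (-(x - y) ^ 2 / (2 * σ ^ 2)) ∂μ := by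
    funext x
    rw [hp, integral_const_mul]
  have hpos : 0 < p x := by
    rw [hp_eq]
    exact mul_pos (by positivity) (integral_exp_pos (integrable_exp_neg_sub_sq_div μ σ x))
  have hderiv : HasDerivAt p ((σ ^ 2)⁻¹ * ∫ y, (y - x) * (Real.sqrt (2 * Real.pi * σ ^ 2))⁻¹ *
      Real.exp (-(x - y) ^ 2 / (2 * σ ^ 2)) ∂μ) x := by
    rw [hp_eq]
    refine ((hasDerivAt_integral_exp_neg_sub_sq_div μ hσ x).const_mul _).congr_deriv ?_
    rw [mul_left_comm, ← integral_const_mul]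
    simp only [mul_left_comm, mul_assoc]
  have hlog := hderiv.log hpos.ne'
  refine ⟨hpos, hlog.differentiableAt, ?_⟩
  rw [hlog.deriv, one_div, mul_inv]
  ring
end

section
/- Let μ be a probability measure on ℝ, let σ : ℝ → ℝ be differentiable with σ t > 0 for all t, and define p : ℝ → ℝ → ℝ by p t x = ∫ (Real.sqrt (2 * π * (σ t)^2))⁻¹ * Real.exp (−(x − y)^2 / (2 * (σ t)^2)) dμ(y). For each t define the probability-flow vector field v t x := −σ t * (deriv σ t) * (deriv (fun x => p t x) x) / (p t x). Then for every continuously differentiable compactly supported test function φ : ℝ → ℝ and every t, the map s ↦ ∫ φ x * p s x dx is differentiable at t with derivative ∂/∂t ∫ φ x * p t x dx = ∫ (deriv φ x) * (v t x) * (p t x) dx; that is, the pair (ρ_t, v_t) satisfies the continuity equation in the weak sense, so the probability flow ODE vector field proportional to the score ∂ₓ log ρ_t follows the variance-exploding density path. -/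
open MeasureTheory Real

/-- The centred Gaussian density of standard deviation `s`. -/
noncomputable def gaussianKernel (s z : ℝ) : ℝ :=
  (√(2 * π * s ^ 2))⁻¹ * exp (-z ^ 2 / (2 * s ^ 2))

/-- The second space derivative of `gaussianKernel`. -/
noncomputable def gaussianKernelSnd (s z : ℝ) : ℝ :=
  (z ^ 2 / s ^ 4 - 1 / s ^ 2) * gaussianKernel s z

lemma gaussianKernel_pos {s : ℝ} (hs : 0 < s) (z : ℝ) : 0 < gaussianKernel s z := by
  unfold gaussianKernel
  positivity

@[fun_prop]
lemma continuous_gaussianKernel (s : ℝ) : Continuous (gaussianKernel s) := by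
  unfold gaussianKernel
  fun_prop

@[fun_prop]
lemma continuous_gaussianKernelSnd (s : ℝ) : Continuous (gaussianKernelSnd s) := by
  unfold gaussianKernelSnd
  fun_prop

lemma inv_sqrt_two_pi_mul_sq_le {s : ℝ} (hs : 0 < s) : (√(2 * π * s ^ 2))⁻¹ ≤ 1 / s := by
  rw [inv_eq_one_div]
  refine one_div_le_one_div_of_le hs (Real.le_sqrt_of_sq_le ?_)
  nlinarith [pi_gt_three, sq_nonneg s]

lemma gaussianKernel_le {s : ℝ} (hs : 0 < s) (z : ℝ) : gaussianKernel s z ≤ 1 / s := by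
  refine le_trans ?_ (inv_sqrt_two_pi_mul_sq_le hs)
  refine mul_le_of_le_one_right (by positivity) (exp_le_one_iff.2 ?_)
  rw [neg_div, neg_nonpos]
  positivity

lemma sq_mul_gaussianKernel_le {s : ℝ} (hs : 0 < s) (z : ℝ) :
    z ^ 2 * gaussianKernel s z ≤ 2 * s := by
  have h : z ^ 2 / (2 * s ^ 2) * exp (-(z ^ 2 / (2 * s ^ 2))) ≤ 1 := by
    rw [exp_neg, ← div_eq_mul_inv, div_le_one (exp_pos _)]
    linarith [add_one_le_exp (z ^ 2 / (2 * s ^ 2))]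
  calc z ^ 2 * gaussianKernel s z
      = 2 * s ^ 2 * ((√(2 * π * s ^ 2))⁻¹ *
          (z ^ 2 / (2 * s ^ 2) * exp (-(z ^ 2 / (2 * s ^ 2))))) := by
        unfold gaussianKernel
        rw [neg_div]
        field_simp
    _ ≤ 2 * s ^ 2 * (1 / s * 1) := by
        gcongr
        exact inv_sqrt_two_pi_mul_sq_le hs
    _ = 2 * s := by field_simp

lemma abs_gaussianKernelSnd_le {s : ℝ} (hs : 0 < s) (z : ℝ) :
    |gaussianKernelSnd s z| ≤ 3 / s ^ 3 := by
  have h : gaussianKernelSnd s z =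
      z ^ 2 * gaussianKernel s z / s ^ 4 - gaussianKernel s z / s ^ 2 := by
    unfold gaussianKernelSnd
    ring
  have hg := (gaussianKernel_pos hs z).le
  have h₁ : z ^ 2 * gaussianKernel s z / s ^ 4 ≤ 2 * s / s ^ 4 :=
    div_le_div_of_nonneg_right (sq_mul_gaussianKernel_le hs z) (by positivity)
  have h₂ : gaussianKernel s z / s ^ 2 ≤ 1 / s / s ^ 2 := by
    gcongr
    exact gaussianKernel_le hs z
  have e : 2 * s / s ^ 4 + 1 / s / s ^ 2 = 3 / s ^ 3 := by
    field_simp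
    norm_num
  rw [h, ← e]
  refine (abs_sub _ _).trans (add_le_add ?_ ?_)
  · rwa [abs_of_nonneg (by positivity)]
  · rwa [abs_of_nonneg (by positivity)]

lemma abs_neg_div_sq_mul_gaussianKernel_le {s : ℝ} (hs : 0 < s) (z : ℝ) :
    |-z / s ^ 2 * gaussianKernel s z| ≤ (1 / s + 2 * s) / s ^ 2 := by
  have hg := gaussianKernel_pos hs z
  rw [abs_mul, abs_div, abs_neg, abs_of_pos hg, abs_of_pos (by positivity : 0 < s ^ 2),
    div_mul_eq_mul_div]
  gcongr
  have hz : |z| ≤ 1 + z ^ 2 := by nlinarith [sq_abs z, sq_nonneg (|z| - 1), abs_nonneg z]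
  calc |z| * gaussianKernel s z ≤ (1 + z ^ 2) * gaussianKernel s z := by gcongr
    _ ≤ 1 / s + 2 * s := by
      linarith [gaussianKernel_le hs z, sq_mul_gaussianKernel_le hs z]

lemma hasDerivAt_gaussianKernel (s z : ℝ) :
    HasDerivAt (gaussianKernel s) (-z / s ^ 2 * gaussianKernel s z) z := by
  have h := ((((hasDerivAt_id z).pow 2).neg.div_const (2 * s ^ 2)).exp).const_mul
    (√(2 * π * s ^ 2))⁻¹
  refine h.congr_deriv ?_
  simp [gaussianKernel]
  ring

lemma hasDerivAt_neg_div_sq_mul_gaussianKernel (s z : ℝ) :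
    HasDerivAt (fun z => -z / s ^ 2 * gaussianKernel s z) (gaussianKernelSnd s z) z := by
  have h := ((hasDerivAt_id z).neg.div_const (s ^ 2)).mul (hasDerivAt_gaussianKernel s z)
  refine h.congr_deriv ?_
  simp only [gaussianKernelSnd, Pi.neg_apply, id]
  ring

/-- The Gaussian kernel solves the heat equation, parametrised by standard deviation. -/
lemma hasDerivAt_gaussianKernel_left {s : ℝ} (hs : 0 < s) (z : ℝ) :
    HasDerivAt (fun s => gaussianKernel s z) (s * gaussianKernelSnd s z) s := by
  have hp : 0 < 2 * π * s ^ 2 := by positivity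
  have hq : 2 * s ^ 2 ≠ 0 := by positivity
  have h₁ := ((((hasDerivAt_id s).pow 2).const_mul (2 * π)).sqrt hp.ne').inv
    (Real.sqrt_pos.2 hp).ne'
  have h₂ := ((hasDerivAt_const s (-z ^ 2)).div (((hasDerivAt_id s).pow 2).const_mul 2) hq).exp
  refine (h₁.mul h₂).congr_deriv ?_
  have hr : √(2 * π * s ^ 2) ≠ 0 := (Real.sqrt_pos.2 hp).ne'
  have hr2 : √(2 * π * s ^ 2) ^ 2 = 2 * π * s ^ 2 := Real.sq_sqrt hp.le
  simp only [gaussianKernelSnd, gaussianKernel, id, Pi.pow_apply, Pi.inv_apply, Pi.div_apply]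
  rw [hr2]
  field_simp
  ring

section Convolution

variable {μ : Measure ℝ} [IsProbabilityMeasure μ]

lemma integrable_comp_sub {h : ℝ → ℝ} (hc : Continuous h) {C : ℝ} (hC : ∀ z, |h z| ≤ C) (x : ℝ) :
    Integrable (fun y => h (x - y)) μ :=
  .of_bound (by fun_prop) C (.of_forall fun y => hC (x - y))

lemma continuous_integral_comp_sub {h : ℝ → ℝ} (hc : Continuous h) {C : ℝ}
    (hC : ∀ z, |h z| ≤ C) : Continuous fun x => ∫ y, h (x - y) ∂μ :=
  continuous_of_dominated (bound := fun _ => C) (fun _ => by fun_prop)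
    (fun x => .of_forall fun y => hC (x - y)) (integrable_const C)
    (.of_forall fun _ => by fun_prop)

lemma hasDerivAt_integral_comp_sub {h h' : ℝ → ℝ} (hd : ∀ z, HasDerivAt h (h' z) z)
    (hc' : Continuous h') {C C' : ℝ} (hC : ∀ z, |h z| ≤ C) (hC' : ∀ z, |h' z| ≤ C') (x : ℝ) :
    HasDerivAt (fun x => ∫ y, h (x - y) ∂μ) (∫ y, h' (x - y) ∂μ) x := by
  have hc : Continuous h := continuous_iff_continuousAt.2 fun z => (hd z).continuousAt
  exact (hasDerivAt_integral_of_dominated_loc_of_deriv_le (bound := fun _ => C')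
    Filter.univ_mem (.of_forall fun _ => by fun_prop) (integrable_comp_sub hc hC x)
    (by fun_prop) (.of_forall fun y x _ => hC' (x - y)) (integrable_const C')
    (.of_forall fun y x _ => (hd (x - y)).comp_sub_const x y)).2

lemma hasDerivAt_integral_gaussianKernel {s : ℝ} (hs : 0 < s) (x : ℝ) :
    HasDerivAt (fun x => ∫ y, gaussianKernel s (x - y) ∂μ)
      (∫ y, -(x - y) / s ^ 2 * gaussianKernel s (x - y) ∂μ) x :=
  hasDerivAt_integral_comp_sub (h' := fun z => -z / s ^ 2 * gaussianKernel s z)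
    (hasDerivAt_gaussianKernel s) (by fun_prop)
    (fun z => (abs_of_pos (gaussianKernel_pos hs z)).trans_le (gaussianKernel_le hs z))
    (abs_neg_div_sq_mul_gaussianKernel_le hs) x

lemma integral_gaussianKernel_pos {s : ℝ} (hs : 0 < s) (x : ℝ) :
    0 < ∫ y, gaussianKernel s (x - y) ∂μ := by
  rw [integral_pos_iff_support_of_nonneg (fun y => (gaussianKernel_pos hs _).le)
    (integrable_comp_sub (by fun_prop)
      (fun z => (abs_of_pos (gaussianKernel_pos hs z)).trans_le (gaussianKernel_le hs z)) x)]
  have : (Function.support fun y => gaussianKernel s (x - y)) = Set.univ :=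
    Set.eq_univ_of_forall fun y => (gaussianKernel_pos hs _).ne'
  simp [this]

lemma abs_mul_gaussianKernelSnd_le {s₀ s : ℝ} (hs₀ : 0 < s₀) (hs : s₀ / 2 < s) (z : ℝ) :
    |s * gaussianKernelSnd s z| ≤ 12 / s₀ ^ 2 := by
  have hpos : 0 < s := by linarith
  rw [abs_mul, abs_of_pos hpos]
  calc s * |gaussianKernelSnd s z| ≤ s * (3 / s ^ 3) := by
        gcongr
        exact abs_gaussianKernelSnd_le hpos z
    _ = 3 / s ^ 2 := by field_simp
    _ ≤ 3 / (s₀ / 2) ^ 2 := by gcongr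
    _ = 12 / s₀ ^ 2 := by
        field_simp
        norm_num

lemma hasDerivAt_integral_gaussianKernel_left {s : ℝ} (hs : 0 < s) (x : ℝ) :
    HasDerivAt (fun s => ∫ y, gaussianKernel s (x - y) ∂μ)
      (∫ y, s * gaussianKernelSnd s (x - y) ∂μ) s :=
  (hasDerivAt_integral_of_dominated_loc_of_deriv_le (bound := fun _ => 12 / s ^ 2)
    (Ioi_mem_nhds (half_lt_self hs)) (.of_forall fun _ => by fun_prop)
    (integrable_comp_sub (by fun_prop)
      (fun z => (abs_of_pos (gaussianKernel_pos hs z)).trans_le (gaussianKernel_le hs z)) x)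
    (by fun_prop) (.of_forall fun y r hr => abs_mul_gaussianKernelSnd_le hs hr (x - y))
    (integrable_const _)
    (.of_forall fun y r hr =>
      hasDerivAt_gaussianKernel_left ((half_pos hs).trans hr) (x - y))).2

lemma continuous_integral_gaussianKernel {s : ℝ} (hs : 0 < s) :
    Continuous fun x => ∫ y, gaussianKernel s (x - y) ∂μ :=
  continuous_integral_comp_sub (by fun_prop)
    fun z => (abs_of_pos (gaussianKernel_pos hs z)).trans_le (gaussianKernel_le hs z)

lemma continuous_integral_gaussianKernelSnd {s : ℝ} (hs : 0 < s) :
    Continuous fun x => ∫ y, gaussianKernelSnd s (x - y) ∂μ :=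
  continuous_integral_comp_sub (by fun_prop) (abs_gaussianKernelSnd_le hs)

/-- The weak heat equation for Gaussian smoothings of `μ`, parametrised by standard deviation. -/
lemma hasDerivAt_integral_mul_integral_gaussianKernel {φ : ℝ → ℝ} (hφ : ContDiff ℝ 1 φ)
    (hφc : HasCompactSupport φ) {s : ℝ} (hs : 0 < s) :
    HasDerivAt (fun s => ∫ x, φ x * ∫ y, gaussianKernel s (x - y) ∂μ)
      (-s * ∫ x, deriv φ x * ∫ y, -(x - y) / s ^ 2 * gaussianKernel s (x - y) ∂μ) s := by
  have hφ₀ := hφ.continuous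
  have hφ₁ := hφ.continuous_deriv le_rfl
  have cg := continuous_integral_gaussianKernel (μ := μ) hs
  have cg₁ : Continuous fun x => ∫ y, -(x - y) / s ^ 2 * gaussianKernel s (x - y) ∂μ :=
    continuous_integral_comp_sub (h := fun z => -z / s ^ 2 * gaussianKernel s z)
      (by fun_prop) (abs_neg_div_sq_mul_gaussianKernel_le hs)
  have cg₂ := continuous_integral_gaussianKernelSnd (μ := μ) hs
  have hparts := integral_mul_deriv_eq_deriv_mul_of_integrable
    (u := φ) (u' := deriv φ) (v' := fun x => ∫ y, gaussianKernelSnd s (x - y) ∂μ)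
    (fun x _ => (hφ.differentiable one_ne_zero x).hasDerivAt)
    (fun x _ => hasDerivAt_integral_comp_sub (μ := μ)
      (hasDerivAt_neg_div_sq_mul_gaussianKernel s)
      (by fun_prop) (abs_neg_div_sq_mul_gaussianKernel_le hs) (abs_gaussianKernelSnd_le hs) x)
    ((hφ₀.mul cg₂).integrable_of_hasCompactSupport hφc.mul_right)
    ((hφ₁.mul cg₁).integrable_of_hasCompactSupport hφc.deriv.mul_right)
    ((hφ₀.mul cg₁).integrable_of_hasCompactSupport hφc.mul_right)
  have key := (hasDerivAt_integral_of_dominated_loc_of_deriv_le (μ := volume)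
    (F := fun s x => φ x * ∫ y, gaussianKernel s (x - y) ∂μ)
    (F' := fun s x => φ x * ∫ y, s * gaussianKernelSnd s (x - y) ∂μ)
    (bound := fun x => |φ x| * (12 / s ^ 2))
    (Ioi_mem_nhds (half_lt_self hs))
    (by
      filter_upwards [Ioi_mem_nhds hs] with r hr
      exact (hφ₀.mul (continuous_integral_gaussianKernel hr)).aestronglyMeasurable)
    ((hφ₀.mul cg).integrable_of_hasCompactSupport hφc.mul_right)
    (by
      simp_rw [integral_const_mul]
      exact (hφ₀.mul (cg₂.const_mul s)).aestronglyMeasurable)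
    (.of_forall fun x r hr => by
      rw [norm_mul, norm_eq_abs]
      gcongr
      simpa using norm_integral_le_of_norm_le_const (μ := μ)
        (f := fun y => r * gaussianKernelSnd r (x - y))
        (.of_forall fun y => abs_mul_gaussianKernelSnd_le hs hr (x - y)))
    ((hφ₀.abs.mul continuous_const).integrable_of_hasCompactSupport hφc.norm.mul_right)
    (.of_forall fun x r hr =>
      (hasDerivAt_integral_gaussianKernel_left ((half_pos hs).trans hr) x).const_mul (φ x))).2
  refine key.congr_deriv ?_
  rw [neg_mul, ← mul_neg, ← hparts, ← integral_const_mul]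
  congr 1 with x
  rw [integral_const_mul]
  ring

end Convolution

/-- The probability-flow ODE vector field
`v t x = -σ(t) σ̇(t) (∂ₓ p t x) / p t x` follows the variance-exploding density
path `p t` in the weak (continuity equation) sense: for every compactly
supported `C¹` test function `φ` and every `t`, the map `s ↦ ∫ φ x * p s x dx`
is differentiable at `t` with derivative `∫ φ'(x) v t x * p t x dx`. -/
theorem ve_probability_flow_continuity_equation
    (μ : Measure ℝ) [IsProbabilityMeasure μ]
    (σ : ℝ → ℝ) (hσ : Differentiable ℝ σ) (hσpos : ∀ t, 0 < σ t)
    (p : ℝ → ℝ → ℝ)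
    (hp : ∀ t x, p t x =
      ∫ y, (Real.sqrt (2 * Real.pi * (σ t) ^ 2))⁻¹ *
        Real.exp (-(x - y) ^ 2 / (2 * (σ t) ^ 2)) ∂μ)
    (v : ℝ → ℝ → ℝ)
    (hv : ∀ t x, v t x =
      -σ t * deriv σ t * deriv (fun x => p t x) x / p t x) :
    ∀ φ : ℝ → ℝ, ContDiff ℝ 1 φ → HasCompactSupport φ →
      ∀ t,
        DifferentiableAt ℝ (fun s => ∫ x, φ x * p s x) t ∧
        deriv (fun s => ∫ x, φ x * p s x) t =
          ∫ x, deriv φ x * v t x * p t x := by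
  obtain rfl : p = fun t x => ∫ y, gaussianKernel (σ t) (x - y) ∂μ := by
    ext t x
    exact hp t x
  intro φ hφ hφc t
  have h := (hasDerivAt_integral_mul_integral_gaussianKernel (μ := μ) hφ hφc (hσpos t)).comp t
    (hσ t).hasDerivAt
  refine ⟨h.differentiableAt, h.deriv.trans ?_⟩
  rw [mul_right_comm, ← integral_const_mul]
  congr 1 with x
  have hpos := integral_gaussianKernel_pos (μ := μ) (hσpos t) x
  rw [hv, (hasDerivAt_integral_gaussianKernel (hσpos t) x).deriv, mul_assoc (deriv φ x),
    div_mul_cancel₀ _ hpos.ne']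
  ring
end
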